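/- arXiv:math/0603189 — 6 statements merged into one kernel-verified Lean document; each statement's English description precedes it below -/
import Mathlib

section
/- Let A be an associative unital ring of prime characteristic p, and let K(A) be the additive subgroup of A generated by all commutators ab − ba. Then for all a, b ∈ A and all integers n ≥ 0, (a + b)^{p^n} − a^{p^n} − b^{p^n} ∈ K(A). -/
/-- For a `p`-group acting on a finite type, summing an invariant function with values in an
additive group of exponent `p` only sees the fixed points. -/
theorem IsPGroup.sum_eq_sum_fixedPoints {p : ℕ} [Fact p.Prime] {G α M : Type*} [Group G]
    (hG : IsPGroup p G) [MulAction G α] [Fintype α] [AddCommGroup M]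
    (hM : ∀ m : M, p • m = 0) (f : α → M) (hf : ∀ (g : G) (x : α), f (g • x) = f x)
    [DecidablePred (· ∈ MulAction.fixedPoints G α)] :
    ∑ x, f x = ∑ x with x ∈ MulAction.fixedPoints G α, f x := by
  classical
  rw [← Finset.sum_filter_add_sum_filter_not Finset.univ (· ∈ MulAction.fixedPoints G α),
    add_eq_left, Finset.sum_partition (MulAction.orbitRel G α)]
  refine Finset.sum_eq_zero fun q hq => ?_
  obtain ⟨x, hx, rfl⟩ := Finset.mem_image.1 hq
  have hx' : x ∉ MulAction.fixedPoints G α := (Finset.mem_filter.1 hx).2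
  have hmem : ∀ y, y ∈ (Finset.univ.filter (· ∉ MulAction.fixedPoints G α)).filter
      (fun y => (Quotient.mk (MulAction.orbitRel G α) y) = Quotient.mk _ x) ↔
      y ∈ MulAction.orbit G x := by
    intro y
    simp only [Finset.mem_filter, Finset.mem_univ, true_and, Quotient.eq, MulAction.orbitRel_apply]
    refine ⟨fun h => h.2, fun h => ⟨fun hy => hx' ?_, h⟩⟩
    obtain ⟨g, rfl⟩ := MulAction.mem_orbit_symm.1 h
    simpa only [hy g] using hy
  rw [Finset.sum_congr rfl (g := fun _ => f x), Finset.sum_const]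
  · have hcard : Finset.card ((Finset.univ.filter (· ∉ MulAction.fixedPoints G α)).filter
        (fun y => (Quotient.mk (MulAction.orbitRel G α) y) = Quotient.mk _ x)) =
        Nat.card (MulAction.orbit G x) := by
      rw [← Nat.card_eq_finsetCard]
      exact Nat.card_congr (Equiv.subtypeEquivRight hmem)
    rw [hcard]
    obtain ⟨n, hn⟩ := hG.card_orbit x
    rcases n with _ | n
    · refine absurd ?_ hx'
      rw [MulAction.mem_fixedPoints_iff_card_orbit_eq_one, ← Nat.card_eq_fintype_card, hn, pow_zero]
    · rw [hn, pow_succ, mul_nsmul', hM, smul_zero]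
  · intro y hy
    obtain ⟨g, rfl⟩ := (hmem y).1 hy
    exact hf g x

/-- The noncommutative expansion of a power of a finite sum over all words. -/
theorem Fintype.sum_pow_eq_sum_prod_ofFn {R ι : Type*} [Semiring R] [Fintype ι] (c : ι → R)
    (n : ℕ) : (∑ i, c i) ^ n = ∑ w : Fin n → ι, (List.ofFn fun i => c (w i)).prod := by
  induction n with
  | zero => simp
  | succ n ih =>
    rw [pow_succ', ih, ← (Fin.consEquiv fun _ => ι).sum_comp, Fintype.sum_prod_type,
      Finset.sum_mul_sum]
    simp [Fin.consEquiv, List.ofFn_succ]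

/-- Modulo commutators, the product of a word is invariant under cyclic rotations. -/
theorem mk_prod_ofFn_rotate {A : Type*} [Ring A] {n : ℕ} [NeZero n] (w : Fin n → A) (g : Fin n) :
    (QuotientAddGroup.mk (List.ofFn fun i => w (i + g)).prod :
      A ⧸ AddSubgroup.closure {x : A | ∃ c d : A, x = c * d - d * c}) =
    QuotientAddGroup.mk (List.ofFn w).prod := by
  obtain ⟨m, rfl⟩ := Nat.exists_eq_succ_of_ne_zero (NeZero.ne n)
  have hone : ∀ v : Fin (m + 1) → A, (QuotientAddGroup.mk (List.ofFn fun i => v (i + 1)).prod :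
      A ⧸ AddSubgroup.closure {x : A | ∃ c d : A, x = c * d - d * c}) =
      QuotientAddGroup.mk (List.ofFn v).prod := by
    intro v
    rw [← sub_eq_zero, ← QuotientAddGroup.mk_sub, QuotientAddGroup.eq_zero_iff]
    refine AddSubgroup.subset_closure ⟨(List.ofFn fun i : Fin m => v i.succ).prod, v 0, ?_⟩
    rw [List.ofFn_succ', List.ofFn_succ (f := v)]
    simp [Fin.coeSucc_eq_succ]
  induction g using Fin.induction with
  | zero => simp
  | succ g ih =>
    rw [← ih, ← hone fun i => w (i + g.castSucc)]
    simp only [← Fin.coeSucc_eq_succ, add_assoc, add_comm (1 : Fin (m + 1))]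

/-- in a ring of prime characteristic `p`, for all `a b` and `n ≥ 0`,
`(a+b)^(p^n) - a^(p^n) - b^(p^n)` lies in the additive subgroup `K(A)` generated by
the commutators `cd - dc`. -/
theorem stmt_2 {A : Type*} [Ring A] (p : ℕ) [Fact p.Prime] [CharP A p]
    (a b : A) (n : ℕ) :
    (a + b) ^ p ^ n - a ^ p ^ n - b ^ p ^ n ∈
      AddSubgroup.closure {x : A | ∃ c d : A, x = c * d - d * c} := by
  classical
  have hp : p.Prime := Fact.out
  have : NeZero (p ^ n) := ⟨(pow_pos hp.pos n).ne'⟩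
  let c : Bool → A := fun t => if t then a else b
  let K := AddSubgroup.closure {x : A | ∃ c d : A, x = c * d - d * c}
  let : MulAction (Multiplicative (Fin (p ^ n))) (Fin (p ^ n) → Bool) :=
    { smul := fun g w i => w (i + g.toAdd)
      one_smul := fun w => funext fun i => congrArg w (add_zero i)
      mul_smul := fun g h w => funext fun i => congrArg w (by
        rw [toAdd_mul, add_assoc]) }
  have hG : IsPGroup p (Multiplicative (Fin (p ^ n))) := IsPGroup.of_card (n := n) (by simp)
  have hM : ∀ m : A ⧸ K, p • m = 0 := by
    intro m
    induction m using QuotientAddGroup.induction_on with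
    | H x => rw [← QuotientAddGroup.mk_nsmul, nsmul_eq_mul, CharP.cast_eq_zero, zero_mul,
        QuotientAddGroup.mk_zero]
  have hsum := hG.sum_eq_sum_fixedPoints hM
    (fun w : Fin (p ^ n) → Bool => ((List.ofFn fun i => c (w i)).prod : A ⧸ K))
    (fun g w => mk_prod_ofFn_rotate (fun i => c (w i)) g.toAdd)
  have hfix : Finset.univ.filter (· ∈ MulAction.fixedPoints (Multiplicative (Fin (p ^ n)))
      (Fin (p ^ n) → Bool)) = {fun _ => true, fun _ => false} := by
    ext w
    simp only [Finset.mem_filter, Finset.mem_univ, true_and, Finset.mem_insert,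
      Finset.mem_singleton]
    constructor
    · intro h
      have hw : ∀ i, w i = w 0 := fun i => by
        have := congrFun (h (Multiplicative.ofAdd i)) 0
        change w (0 + i) = w 0 at this
        rwa [zero_add] at this
      cases h0 : w 0
      · exact Or.inr (funext fun i => (hw i).trans h0)
      · exact Or.inl (funext fun i => (hw i).trans h0)
    · rintro (rfl | rfl) <;> exact fun _ => rfl
  have hne : (fun _ : Fin (p ^ n) => true) ≠ fun _ => false := fun h => by
    simpa using congrFun h 0
  have hab : a + b = ∑ t, c t := by simp [c]
  rw [hfix, Finset.sum_pair hne] at hsum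
  rw [← QuotientAddGroup.eq_zero_iff, hab, Fintype.sum_pow_eq_sum_prod_ofFn, sub_sub,
    QuotientAddGroup.mk_sub, QuotientAddGroup.mk_add, sub_eq_zero]
  have hs := map_sum (QuotientAddGroup.mk' K)
    (fun w : Fin (p ^ n) → Bool => (List.ofFn fun i => c (w i)).prod) Finset.univ
  refine hs.trans (hsum.trans ?_)
  simp only [c, if_true, Bool.false_eq_true, if_false, List.ofFn_const, List.prod_replicate]
  rfl
end

section
/- For every integer n ≥ 0, the set T_n(Λ) = {x ∈ Λ : x^{p^n} ∈ K(Λ)} is a k-subspace of Λ containing the commutator space K(Λ). -/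
/- Common setup: Λ is a finite-dimensional k-algebra, Λ* = Hom_k(Λ,k) its dual,
  made into a Λ-Λ-bimodule by (a•φ) b = φ (b*a) and (op a • φ) b = φ (a*b).
  The trivial extension T(Λ) = Λ ⋉ Λ* is realized as `TrivSqZeroExt Λ (Module.Dual k Λ)`,
  whose multiplication is (a,φ)·(b,ψ) = (ab, a•ψ + φ•b). -/

open TrivSqZeroExt MulOpposite

section Setup

variable (k Λ : Type*) [Field k] [Ring Λ] [Algebra k Λ]

/-- Left action of `Λ` on its `k`-linear dual: `(a • φ) b = φ (b * a)`. -/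
noncomputable instance dualLeftSMul : SMul Λ (Module.Dual k Λ) :=
  ⟨fun a φ => φ ∘ₗ LinearMap.mulRight k a⟩

/-- Right action of `Λ` on its `k`-linear dual: `(op a • φ) b = φ (a * b)`. -/
noncomputable instance dualRightSMul : SMul Λᵐᵒᵖ (Module.Dual k Λ) :=
  ⟨fun a φ => φ ∘ₗ LinearMap.mulLeft k a.unop⟩

variable {k Λ}

@[simp] lemma dual_lsmul_apply (a : Λ) (φ : Module.Dual k Λ) (b : Λ) :
    (a • φ) b = φ (b * a) := rfl

@[simp] lemma dual_rsmul_apply (a : Λᵐᵒᵖ) (φ : Module.Dual k Λ) (b : Λ) :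
    (a • φ) b = φ (a.unop * b) := rfl

variable (k Λ)

noncomputable instance dualLeftModule : Module Λ (Module.Dual k Λ) where
  one_smul φ := by ext b; simp
  mul_smul a b φ := by ext c; simp [mul_assoc]
  smul_zero a := by ext; simp
  smul_add a φ ψ := by ext; simp
  add_smul a b φ := by ext c; simp [mul_add]
  zero_smul φ := by ext; simp

noncomputable instance dualRightModule : Module Λᵐᵒᵖ (Module.Dual k Λ) where
  one_smul φ := by ext b; simp
  mul_smul a b φ := by ext c; simp [mul_assoc]
  smul_zero a := by ext; simp
  smul_add a φ ψ := by ext; simp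
  add_smul a b φ := by ext c; simp [add_mul]
  zero_smul φ := by ext; simp

noncomputable instance dualSMulCommClass : SMulCommClass Λ Λᵐᵒᵖ (Module.Dual k Λ) where
  smul_comm a b φ := by ext c; simp [mul_assoc]

/-- The commutator space `K(A)` of an algebra `A`:
the `k`-subspace spanned by all commutators `a*b - b*a`. -/
def commSpace (A : Type*) [Ring A] [Module k A] : Submodule k A :=
  Submodule.span k {x : A | ∃ a b : A, x = a * b - b * a}

/-- `[Λ,Λ*]`: the `k`-subspace of `Λ*` spanned by all `a•φ - φ•a`. -/
noncomputable def dualCommSpace : Submodule k (Module.Dual k Λ) :=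
  Submodule.span k
    {ψ : Module.Dual k Λ | ∃ (a : Λ) (φ : Module.Dual k Λ), ψ = a • φ - op a • φ}

/-- The trivial extension `T(Λ) = Λ ⋉ Λ*`. -/
abbrev TrivExt := TrivSqZeroExt Λ (Module.Dual k Λ)

/-- The symmetrizing bilinear form on `T(Λ)`: `⟨(a,φ),(b,ψ)⟩ = ψ a + φ b`. -/
noncomputable def trivExtForm (x y : TrivExt k Λ) : k := y.snd x.fst + x.snd y.fst

end Setup

section CommutatorSpace

open Polynomial

variable {k Λ : Type*} [Field k] [Ring Λ] [Algebra k Λ]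

lemma mul_sub_mul_mem_commSpace (a b : Λ) : a * b - b * a ∈ commSpace k Λ :=
  Submodule.subset_span ⟨a, b, rfl⟩

lemma coeff_mul_sub_mul_mem_commSpace (f g : Λ[X]) (i : ℕ) :
    (f * g - g * f).coeff i ∈ commSpace k Λ := by
  rw [coeff_sub, coeff_mul, coeff_mul, ← Finset.Nat.sum_antidiagonal_swap (n := i),
    ← Finset.sum_sub_distrib]
  exact Submodule.sum_mem _ fun _ _ => mul_sub_mul_mem_commSpace _ _

/-- Modulo commutators, the derivative of a power obeys the commutative rule. -/
lemma coeff_derivative_pow_mul_pow_mem_commSpace (q : Λ[X]) (m j i : ℕ) :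
    (derivative (q ^ (m + 1)) * q ^ j - (m + 1) • (q ^ (m + j) * derivative q)).coeff i
      ∈ commSpace k Λ := by
  induction m generalizing j with
  | zero => simpa using coeff_mul_sub_mul_mem_commSpace (derivative q) (q ^ j) i
  | succ m ih =>
    have key : derivative (q ^ (m + 1 + 1)) * q ^ j
          - (m + 1 + 1) • (q ^ (m + 1 + j) * derivative q)
        = (derivative (q ^ (m + 1)) * q ^ (j + 1)
            - (m + 1) • (q ^ (m + (j + 1)) * derivative q))
          + ((q ^ (m + 1) * derivative q) * q ^ j
            - q ^ j * (q ^ (m + 1) * derivative q)) := by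
      rw [pow_succ q (m + 1), derivative_mul, add_mul, mul_assoc _ q (q ^ j), ← pow_succ',
        ← mul_assoc (q ^ j), ← pow_add, show m + (j + 1) = m + 1 + j by ring,
        show j + (m + 1) = m + 1 + j by ring, succ_nsmul _ (m + 1)]
      abel
    rw [key, coeff_add]
    exact add_mem (ih (j + 1)) (coeff_mul_sub_mul_mem_commSpace _ _ _)

variable (p : ℕ) [Fact p.Prime] [CharP k p]

lemma coeff_pow_char_mem_commSpace (q : Λ[X]) {i : ℕ} (hi : i + 1 < p) :
    (q ^ p).coeff (i + 1) ∈ commSpace k Λ := by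
  have hp : p - 1 + 1 = p := Nat.sub_add_cancel (Fact.out : p.Prime).one_le
  have h := coeff_derivative_pow_mul_pow_mem_commSpace (k := k) q (p - 1) 0 i
  have hzero : ∀ a : Λ, p • a = 0 := fun a => by
    rw [← Nat.cast_smul_eq_nsmul k, CharP.cast_eq_zero, zero_smul]
  rw [hp, pow_zero, mul_one, coeff_sub, coeff_smul, hzero, sub_zero, coeff_derivative] at h
  have hne : ((i + 1 : ℕ) : k) ≠ 0 := fun h0 =>
    Nat.not_dvd_of_pos_of_lt i.succ_pos hi ((CharP.cast_eq_zero_iff k p _).1 h0)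
  refine (Submodule.smul_mem_iff _ hne).1 ?_
  rw [Nat.cast_smul_eq_nsmul, nsmul_eq_mul, Nat.cast_comm]
  exact_mod_cast h

lemma add_pow_char_sub_mem_commSpace (x y : Λ) :
    (x + y) ^ p - (x ^ p + y ^ p) ∈ commSpace k Λ := by
  set q : Λ[X] := C y * X + C x with hq
  have hdeg : q.natDegree ≤ 1 := natDegree_linear_le
  have heval : (x + y) ^ p = (q ^ p).eval 1 := by
    have := map_pow (eval₂RingHom' (RingHom.id Λ) 1 fun a => Commute.one_right a) q p
    simp only [eval₂RingHom', RingHom.coe_mk, MonoidHom.coe_mk, OneHom.coe_mk] at this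
    rw [eval, this, hq]
    simp [add_comm]
  have hlt : (q ^ p).natDegree < p + 1 :=
    Nat.lt_succ_of_le (by simpa using natDegree_pow_le_of_le p hdeg)
  have h0 : (q ^ p).coeff 0 = x ^ p := by
    have := map_pow (constantCoeff (R := Λ)) q p
    simpa [hq] using this
  have h1 : (q ^ p).coeff p = y ^ p := by
    have := coeff_pow_of_natDegree_le (m := p) hdeg
    simpa [hq, coeff_C] using this
  have hp : p - 1 + 1 = p := Nat.sub_add_cancel (Fact.out : p.Prime).one_le
  have hsum : (x + y) ^ p - (x ^ p + y ^ p)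
      = ∑ i ∈ Finset.range (p - 1), (q ^ p).coeff (i + 1) := by
    rw [heval, eval_eq_sum_range' hlt, Finset.sum_range_succ, ← h0, ← h1]
    conv_lhs => enter [1, 1, 1]; rw [← hp]
    rw [Finset.sum_range_succ']
    simp only [one_pow, mul_one]
    abel
  rw [hsum]
  exact Submodule.sum_mem _ fun i hi =>
    coeff_pow_char_mem_commSpace p q (by have := Finset.mem_range.1 hi; omega)

lemma mul_pow_sub_mul_pow_mem_commSpace (a b : Λ) {m : ℕ} (hm : m ≠ 0) :
    (a * b) ^ m - (b * a) ^ m ∈ commSpace k Λ := by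
  obtain ⟨m, rfl⟩ := Nat.exists_eq_succ_of_ne_zero hm
  have h : (b * a) ^ (m + 1) = b * (a * b) ^ m * a := by
    induction m with
    | zero => simp
    | succ m ih => rw [pow_succ, ih (by simp), pow_succ]; simp only [mul_assoc]
  rw [Nat.succ_eq_add_one, h, pow_succ', mul_assoc a b]
  exact mul_sub_mul_mem_commSpace _ _

lemma pow_char_mem_commSpace {x : Λ} (hx : x ∈ commSpace k Λ) : x ^ p ∈ commSpace k Λ := by
  have hp : p ≠ 0 := (Fact.out : p.Prime).ne_zero
  induction hx using Submodule.span_induction with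
  | mem x hx =>
    obtain ⟨a, b, rfl⟩ := hx
    have h := sub_mem (mul_pow_sub_mul_pow_mem_commSpace (k := k) a b hp)
      (add_pow_char_sub_mem_commSpace (k := k) p (a * b - b * a) (b * a))
    rw [sub_add_cancel] at h
    convert h using 1
    abel
  | zero => simp [hp]
  | add x y _ _ hx hy =>
    simpa using add_mem (add_pow_char_sub_mem_commSpace (k := k) p x y) (add_mem hx hy)
  | smul c x _ hx =>
    rw [_root_.smul_pow]
    exact Submodule.smul_mem _ _ hx

lemma pow_char_pow_mem_commSpace (n : ℕ) {x : Λ} (hx : x ∈ commSpace k Λ) :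
    x ^ p ^ n ∈ commSpace k Λ := by
  induction n with
  | zero => simpa using hx
  | succ n ih =>
    rw [pow_succ, pow_mul]
    exact pow_char_mem_commSpace p ih

lemma add_pow_char_pow_sub_mem_commSpace (n : ℕ) (x y : Λ) :
    (x + y) ^ p ^ n - (x ^ p ^ n + y ^ p ^ n) ∈ commSpace k Λ := by
  induction n with
  | zero => simp
  | succ n ih =>
    simp only [pow_succ, pow_mul]
    set u := x ^ p ^ n
    set v := y ^ p ^ n
    have h₁ := add_pow_char_sub_mem_commSpace (k := k) p ((x + y) ^ p ^ n - (u + v)) (u + v)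
    rw [sub_add_cancel] at h₁
    have h₂ := add_pow_char_sub_mem_commSpace (k := k) p u v
    convert add_mem (add_mem h₁ h₂) (pow_char_mem_commSpace p ih) using 1
    abel

end CommutatorSpace

/-- for every `n ≥ 0`, `T_n(Λ) = {x | x^(p^n) ∈ K(Λ)}` is a `k`-subspace
of `Λ` containing the commutator space `K(Λ)`. -/
theorem stmt_3 (k Λ : Type*) [Field k] (p : ℕ) [Fact p.Prime] [CharP k p]
    [Ring Λ] [Algebra k Λ] [FiniteDimensional k Λ] (n : ℕ) :
    ∃ V : Submodule k Λ,
      (∀ x : Λ, x ∈ V ↔ x ^ p ^ n ∈ commSpace k Λ) ∧ commSpace k Λ ≤ V := by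
  refine ⟨{ carrier := {x | x ^ p ^ n ∈ commSpace k Λ}
            add_mem' := fun {x y} hx hy => ?_
            zero_mem' := ?_
            smul_mem' := fun c x hx => ?_ }, fun _ => Iff.rfl,
    fun x hx => pow_char_pow_mem_commSpace p n hx⟩
  · simpa using add_mem (add_pow_char_pow_sub_mem_commSpace (k := k) p n x y) (add_mem hx hy)
  · simp [(Fact.out : p.Prime).ne_zero]
  · simpa only [Set.mem_ofPred_eq, smul_pow] using Submodule.smul_mem _ (c ^ p ^ n) hx
end

section
/- For every integer n ≥ 1, the generalized Reynolds ideal of the trivial extension satisfies T_n(T(Λ))^⊥ = 0 ⋉ Ann_{Λ*}(T_n(Λ)); that is, with respect to the form ⟨(a,φ),(b,ψ)⟩ = ψ(a) + φ(b), the orthogonal space of T_n(T(Λ)) consists exactly of the elements (0,ψ) with ψ vanishing on T_n(Λ). -/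
/- Common setup: Λ is a finite-dimensional k-algebra, Λ* = Hom_k(Λ,k) its dual,
  made into a Λ-Λ-bimodule by (a•φ) b = φ (b*a) and (op a • φ) b = φ (a*b).
  The trivial extension T(Λ) = Λ ⋉ Λ* is realized as `TrivSqZeroExt Λ (Module.Dual k Λ)`,
  whose multiplication is (a,φ)·(b,ψ) = (ab, a•ψ + φ•b). -/

open TrivSqZeroExt MulOpposite

/-- The inclusion of `Λ` into its trivial extension preserves commutator spaces. -/
lemma inl_mem_commSpace {k Λ : Type*} [Field k] [Ring Λ] [Algebra k Λ] {a : Λ}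
    (ha : a ∈ commSpace k Λ) : (inl a : TrivExt k Λ) ∈ commSpace k (TrivExt k Λ) := by
  induction ha using Submodule.span_induction with
  | mem _ h =>
    obtain ⟨b, c, rfl⟩ := h
    exact Submodule.subset_span ⟨inl b, inl c, by simp [inl_sub]⟩
  | zero => simp
  | add _ _ _ _ hx hy => simpa only [inl_add] using add_mem hx hy
  | smul r _ _ hx => simpa only [inl_smul] using Submodule.smul_mem _ r hx

/-- The inclusion of `Λ*` into the trivial extension sends `[Λ,Λ*]` to commutators. -/
lemma inr_mem_commSpace {k Λ : Type*} [Field k] [Ring Λ] [Algebra k Λ] {φ : Module.Dual k Λ}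
    (hφ : φ ∈ dualCommSpace k Λ) : (inr φ : TrivExt k Λ) ∈ commSpace k (TrivExt k Λ) := by
  induction hφ using Submodule.span_induction with
  | mem _ h =>
    obtain ⟨a, ψ, rfl⟩ := h
    exact Submodule.subset_span ⟨inl a, inr ψ, by simp [inl_mul_inr, inr_mul_inl, inr_sub]⟩
  | zero => simp
  | add _ _ _ _ hx hy => simpa only [inr_add] using add_mem hx hy
  | smul r _ _ hx => simpa only [inr_smul] using Submodule.smul_mem _ r hx

/-- The projection of the trivial extension onto `Λ` preserves commutator spaces. -/
lemma fst_mem_commSpace {k Λ : Type*} [Field k] [Ring Λ] [Algebra k Λ] {x : TrivExt k Λ}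
    (hx : x ∈ commSpace k (TrivExt k Λ)) : x.fst ∈ commSpace k Λ := by
  induction hx using Submodule.span_induction with
  | mem _ h =>
    obtain ⟨b, c, rfl⟩ := h
    exact Submodule.subset_span ⟨b.fst, c.fst, by simp⟩
  | zero => simp
  | add _ _ _ _ hx hy => simpa only [fst_add] using add_mem hx hy
  | smul r _ _ hx => simpa only [fst_smul] using Submodule.smul_mem _ r hx

/-- Modulo `[Λ,Λ*]`, the `Λ*`-component of `x ^ m` is `m` times `x.fst ^ (m - 1) • x.snd`. -/
lemma snd_pow_sub_mem_dualCommSpace {k Λ : Type*} [Field k] [Ring Λ] [Algebra k Λ]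
    (x : TrivExt k Λ) (m : ℕ) :
    (x ^ (m + 1)).snd - (m + 1) • (x.fst ^ m • x.snd) ∈ dualCommSpace k Λ := by
  have hsum : (x ^ (m + 1)).snd =
      ∑ i ∈ Finset.range (m + 1), op (x.fst ^ i) • x.fst ^ (m - i) • x.snd := by
    rw [snd_pow_eq_sum]
    rfl
  have hconst : (m + 1) • (x.fst ^ m • x.snd) =
      ∑ _i ∈ Finset.range (m + 1), x.fst ^ m • x.snd := by
    simp
  rw [hsum, hconst, ← Finset.sum_sub_distrib]
  refine sum_mem fun i hi => ?_
  have him : i + (m - i) = m := by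
    have := Finset.mem_range.mp hi
    omega
  rw [← neg_mem_iff, neg_sub]
  refine Submodule.subset_span ⟨x.fst ^ i, x.fst ^ (m - i) • x.snd, ?_⟩
  rw [smul_smul, ← pow_add, him]

/-- If `m` vanishes in `k`, whether `x ^ m` is a sum of commutators depends only on `x.fst`. -/
lemma pow_mem_commSpace_iff {k Λ : Type*} [Field k] [Ring Λ] [Algebra k Λ]
    (x : TrivExt k Λ) {m : ℕ} (hm : (m : k) = 0) (hm0 : m ≠ 0) :
    x ^ m ∈ commSpace k (TrivExt k Λ) ↔ x.fst ^ m ∈ commSpace k Λ := by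
  refine ⟨fun h => by simpa using fst_mem_commSpace h, fun h => ?_⟩
  have hs : (x ^ m).snd ∈ dualCommSpace k Λ := by
    obtain ⟨l, rfl⟩ := Nat.exists_eq_succ_of_ne_zero hm0
    have := snd_pow_sub_mem_dualCommSpace x l
    rwa [← Nat.cast_smul_eq_nsmul k, hm, zero_smul, sub_zero] at this
  rw [← inl_fst_add_inr_snd_eq (x ^ m), fst_pow]
  exact add_mem (inl_mem_commSpace h) (inr_mem_commSpace hs)

/-- for `n ≥ 1`, `T_n(T(Λ))^⊥ = 0 ⋉ Ann_{Λ*}(T_n(Λ))`: an element `(a,φ)`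
is orthogonal to `T_n(T(Λ)) = {y | y^(p^n) ∈ K(T(Λ))}` iff `a = 0` and `φ` vanishes on
`T_n(Λ) = {b | b^(p^n) ∈ K(Λ)}`. -/
theorem stmt_11 (k Λ : Type*) [Field k] (p : ℕ) [Fact p.Prime] [CharP k p]
    [Ring Λ] [Algebra k Λ] [FiniteDimensional k Λ] (n : ℕ) (hn : 1 ≤ n)
    (x : TrivExt k Λ) :
    (∀ y : TrivExt k Λ, y ^ p ^ n ∈ commSpace k (TrivExt k Λ) →
        trivExtForm k Λ x y = 0) ↔
      (x.fst = 0 ∧ ∀ a : Λ, a ^ p ^ n ∈ commSpace k Λ → x.snd a = 0) := by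
  have hm : ((p ^ n : ℕ) : k) = 0 := by
    rw [Nat.cast_pow, CharP.cast_eq_zero, zero_pow (by omega)]
  have hm0 : p ^ n ≠ 0 := pow_ne_zero n (Fact.out : p.Prime).ne_zero
  simp only [pow_mem_commSpace_iff _ hm hm0]
  constructor
  · intro h
    have hfst : x.fst = 0 := by
      refine (Module.forall_dual_apply_eq_zero_iff k x.fst).mp fun ψ => ?_
      simpa [trivExtForm] using h (inr ψ) (by simp [zero_pow hm0])
    exact ⟨hfst, fun a ha => by simpa [trivExtForm] using h (inl a) (by simpa using ha)⟩
  · rintro ⟨hfst, hsnd⟩ y hy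
    simp [trivExtForm, hfst, hsnd _ hy]
end

section
/- For every integer n ≥ 1, T_n(Z(T(Λ))) = T_n(Z(Λ)) ⋉ Ann_{Λ*}(K(Λ)); that is, a central element (z,ψ) ∈ Z(T(Λ)) satisfies (z,ψ)^{p^n} = 0 if and only if z^{p^n} = 0. (Since the centers are commutative, their commutator spaces vanish, so T_n of a center consists of the elements whose p^n-th power is zero.) -/
/- Common setup: Λ is a finite-dimensional k-algebra, Λ* = Hom_k(Λ,k) its dual,
  made into a Λ-Λ-bimodule by (a•φ) b = φ (b*a) and (op a • φ) b = φ (a*b).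
  The trivial extension T(Λ) = Λ ⋉ Λ* is realized as `TrivSqZeroExt Λ (Module.Dual k Λ)`,
  whose multiplication is (a,φ)·(b,ψ) = (ab, a•ψ + φ•b). -/

open TrivSqZeroExt MulOpposite

lemma op_smul_eq_smul_iff_forall_commSpace {k Λ : Type*} [Field k] [Ring Λ] [Algebra k Λ]
    (φ : Module.Dual k Λ) :
    (∀ a : Λ, op a • φ = a • φ) ↔ ∀ v ∈ commSpace k Λ, φ v = 0 := by
  constructor
  · intro h v hv
    have hle : commSpace k Λ ≤ LinearMap.ker φ := by
      refine Submodule.span_le.2 ?_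
      rintro _ ⟨a, b, rfl⟩
      have := LinearMap.congr_fun (h a) b
      simp only [dual_rsmul_apply, dual_lsmul_apply, unop_op] at this
      simp [this]
    exact hle hv
  · intro h a
    ext b
    have := h (a * b - b * a) (Submodule.subset_span ⟨a, b, rfl⟩)
    rw [map_sub, sub_eq_zero] at this
    simpa using this

lemma trivExt_mem_center_iff {k Λ : Type*} [Field k] [Ring Λ] [Algebra k Λ] (x : TrivExt k Λ) :
    x ∈ Subring.center (TrivExt k Λ) ↔
      x.fst ∈ Subring.center Λ ∧ ∀ v ∈ commSpace k Λ, x.snd v = 0 := by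
  rw [← op_smul_eq_smul_iff_forall_commSpace, Subring.mem_center_iff, Subring.mem_center_iff]
  constructor
  · intro h
    refine ⟨fun a => ?_, fun a => ?_⟩
    · simpa using congrArg TrivSqZeroExt.fst (h (inl a))
    · simpa using (congrArg TrivSqZeroExt.snd (h (inl a))).symm
  · rintro ⟨hz, hψ⟩ y
    refine TrivSqZeroExt.ext (by simpa using hz y.fst) ?_
    have hy : op x.fst • y.snd = x.fst • y.snd := by
      ext b
      simp [hz b]
    rw [TrivSqZeroExt.snd_mul, TrivSqZeroExt.snd_mul, hψ, hy, add_comm]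

lemma trivExt_pow_eq_zero_iff_of_mem_center {k Λ : Type*} [Field k] (p : ℕ) [CharP k p]
    [Ring Λ] [Algebra k Λ] {m : ℕ} (hm : p ∣ m) {x : TrivExt k Λ}
    (hx : x ∈ Subring.center (TrivExt k Λ)) :
    x ^ m = 0 ↔ x.fst ^ m = 0 := by
  constructor
  · intro h
    simpa using congrArg TrivSqZeroExt.fst h
  · intro h
    refine TrivSqZeroExt.ext (by simpa using h) ?_
    have hψ := (op_smul_eq_smul_iff_forall_commSpace x.snd).2 ((trivExt_mem_center_iff x).1 hx).2
    rw [TrivSqZeroExt.snd_pow_of_smul_comm x m (hψ x.fst)]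
    ext v
    have : (m : k) = 0 := (CharP.cast_eq_zero_iff k p m).2 hm
    simp [this]

/-- for `n ≥ 1`, `T_n(Z(T(Λ))) = T_n(Z(Λ)) ⋉ Ann_{Λ*}(K(Λ))`: a central
element `(z,ψ)` of `T(Λ)` satisfies `(z,ψ)^(p^n) = 0` iff `z^(p^n) = 0`; equivalently,
`(z,ψ)` is central with `(z,ψ)^(p^n) = 0` iff `z` is central with `z^(p^n) = 0` and
`ψ` vanishes on `K(Λ)`. -/
theorem stmt_12 (k Λ : Type*) [Field k] (p : ℕ) [Fact p.Prime] [CharP k p]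
    [Ring Λ] [Algebra k Λ] [FiniteDimensional k Λ] (n : ℕ) (hn : 1 ≤ n) :
    (∀ x ∈ Subring.center (TrivExt k Λ),
      (x ^ p ^ n = 0 ↔ TrivSqZeroExt.fst x ^ p ^ n = 0)) ∧
    (∀ x : TrivExt k Λ,
      (x ∈ Subring.center (TrivExt k Λ) ∧ x ^ p ^ n = 0) ↔
        (x.fst ∈ Subring.center Λ ∧ x.fst ^ p ^ n = 0 ∧
          ∀ v ∈ commSpace k Λ, x.snd v = 0)) := by
  have hp : p ∣ p ^ n := dvd_pow_self p (Nat.one_le_iff_ne_zero.1 hn)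
  refine ⟨fun x hx => trivExt_pow_eq_zero_iff_of_mem_center p hp hx, fun x => ?_⟩
  rw [and_congr_right fun hx => trivExt_pow_eq_zero_iff_of_mem_center p hp hx,
    trivExt_mem_center_iff]
  tauto
end

section
/- For every integer n ≥ 1, the orthogonal space of T_n(Z(T(Λ))) in T(Λ) with respect to the form ⟨(a,φ),(b,ψ)⟩ = ψ(a) + φ(b) equals K(Λ) ⋉ Ann_{Λ*}(T_n(Z(Λ))); that is, (a,φ) ⊥ T_n(Z(T(Λ))) if and only if a ∈ K(Λ) and φ vanishes on {z ∈ Z(Λ) : z^{p^n} = 0}. (Modulo K(T(Λ)) = K(Λ) ⋉ [Λ,Λ*], this gives T_n(Z(T(Λ)))^⊥ / K(T(Λ)) = 0 ⋉ (Ann_{Λ*}(T_n(Z(Λ))) / [Λ,Λ*]).) -/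
/- Common setup: Λ is a finite-dimensional k-algebra, Λ* = Hom_k(Λ,k) its dual,
  made into a Λ-Λ-bimodule by (a•φ) b = φ (b*a) and (op a • φ) b = φ (a*b).
  The trivial extension T(Λ) = Λ ⋉ Λ* is realized as `TrivSqZeroExt Λ (Module.Dual k Λ)`,
  whose multiplication is (a,φ)·(b,ψ) = (ab, a•ψ + φ•b). -/

open TrivSqZeroExt MulOpposite

/-- A linear form vanishes on the commutator space iff it is a trace form. -/
lemma commSpace_le_ker_iff {k Λ : Type*} [Field k] [Ring Λ] [Algebra k Λ]
    {ψ : Module.Dual k Λ} :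
    commSpace k Λ ≤ LinearMap.ker ψ ↔ ∀ a b : Λ, ψ (a * b) = ψ (b * a) := by
  rw [commSpace, Submodule.span_le]
  constructor
  · intro h a b
    have : ψ (a * b - b * a) = 0 := h ⟨a, b, rfl⟩
    rwa [map_sub, sub_eq_zero] at this
  · rintro h _ ⟨a, b, rfl⟩
    simp [h a b]

namespace TrivExt

variable {k Λ : Type*} [Field k] [Ring Λ] [Algebra k Λ]

/-- An element `(z, ψ)` of `T(Λ)` is central iff `z` is central in `Λ` and `ψ` is a trace form. -/
lemma mem_center_iff {y : TrivExt k Λ} :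
    y ∈ Subring.center (TrivExt k Λ) ↔
      y.fst ∈ Subring.center Λ ∧ ∀ a b : Λ, y.snd (a * b) = y.snd (b * a) := by
  simp only [Subring.mem_center_iff]
  constructor
  · intro h
    refine ⟨fun a => ?_, fun a b => ?_⟩
    · simpa using congrArg TrivSqZeroExt.fst (h (inl a))
    · simpa using (LinearMap.congr_fun (congrArg TrivSqZeroExt.snd (h (inl b))) a)
  · rintro ⟨hz, hψ⟩ g
    ext b
    · simpa using hz g.fst
    · simp [hψ b g.fst, hz b, add_comm]

lemma inl_mem_center {z : Λ} (hz : z ∈ Subring.center Λ) :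
    (inl z : TrivExt k Λ) ∈ Subring.center (TrivExt k Λ) :=
  mem_center_iff.2 ⟨by simpa using hz, by simp⟩

lemma inr_mem_center {ψ : Module.Dual k Λ} (hψ : ∀ a b : Λ, ψ (a * b) = ψ (b * a)) :
    (inr ψ : TrivExt k Λ) ∈ Subring.center (TrivExt k Λ) :=
  mem_center_iff.2 ⟨by simp, by simpa using hψ⟩

end TrivExt

/-- for `n ≥ 1`, the orthogonal space of `T_n(Z(T(Λ)))` in `T(Λ)` equals
`K(Λ) ⋉ Ann_{Λ*}(T_n(Z(Λ)))`: `(a,φ)` is orthogonal to all central `y` with `y^(p^n) = 0`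
iff `a ∈ K(Λ)` and `φ` vanishes on `{z ∈ Z(Λ) | z^(p^n) = 0}`. -/
theorem stmt_13 (k Λ : Type*) [Field k] (p : ℕ) [Fact p.Prime] [CharP k p]
    [Ring Λ] [Algebra k Λ] [FiniteDimensional k Λ] (n : ℕ) (hn : 1 ≤ n)
    (x : TrivExt k Λ) :
    (∀ y : TrivExt k Λ, y ∈ Subring.center (TrivExt k Λ) → y ^ p ^ n = 0 →
        trivExtForm k Λ x y = 0) ↔
      (x.fst ∈ commSpace k Λ ∧
        ∀ z ∈ Subring.center Λ, z ^ p ^ n = 0 → x.snd z = 0) := by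
  constructor
  · intro h
    refine ⟨?_, fun z hz hzn => ?_⟩
    · by_contra hx
      obtain ⟨ψ, hψx, hψ⟩ := Submodule.exists_le_ker_of_notMem hx
      refine hψx ?_
      have hsq : (inr ψ : TrivExt k Λ) ^ 2 = 0 := by rw [sq, inr_mul_inr]
      have hle : 2 ≤ p ^ n :=
        (Fact.out : p.Prime).two_le.trans (Nat.le_self_pow (by lia) p)
      simpa [trivExtForm] using
        h (inr ψ) (TrivExt.inr_mem_center (commSpace_le_ker_iff.1 hψ))
          (pow_eq_zero_of_le hle hsq)
    · simpa [trivExtForm] using h (inl z) (TrivExt.inl_mem_center hz)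
        (by rw [inl_pow, hzn, inl_zero])
  · rintro ⟨hK, hann⟩ y hy hyn
    obtain ⟨hz, hψ⟩ := TrivExt.mem_center_iff.1 hy
    have hyK : y.snd x.fst = 0 := commSpace_le_ker_iff.2 hψ hK
    have hyz : x.snd y.fst = 0 := hann _ hz (by rw [← fst_pow, hyn, fst_zero])
    rw [trivExtForm, hyK, hyz, add_zero]
end

section
/- For every integer n ≥ 1, the subspace P_n(Z(T(Λ))) of Z(T(Λ)) spanned by all p^n-th powers of central elements of T(Λ) equals P_n(Z(Λ)) ⋉ 0, and its orthogonal space in T(Λ) with respect to the form ⟨(a,φ),(b,ψ)⟩ = ψ(a) + φ(b) equals Λ ⋉ Ann_{Λ*}(P_n(Z(Λ))); that is, (a,φ) ⊥ P_n(Z(T(Λ))) if and only if φ(z^{p^n}) = 0 for all z ∈ Z(Λ), with no condition on a. (Modulo K(T(Λ)) = K(Λ) ⋉ [Λ,Λ*], this gives P_n(Z(T(Λ)))^⊥ / K(T(Λ)) = Λ/K(Λ) ⋉ (Ann_{Λ*}(P_n(Z(Λ))) / [Λ,Λ*]).) -/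
/- Common setup: Λ is a finite-dimensional k-algebra, Λ* = Hom_k(Λ,k) its dual,
  made into a Λ-Λ-bimodule by (a•φ) b = φ (b*a) and (op a • φ) b = φ (a*b).
  The trivial extension T(Λ) = Λ ⋉ Λ* is realized as `TrivSqZeroExt Λ (Module.Dual k Λ)`,
  whose multiplication is (a,φ)·(b,ψ) = (ab, a•ψ + φ•b). -/

open TrivSqZeroExt MulOpposite

/-- The inclusion `Λ → T(Λ)` as a `k`-linear map. -/
def trivExtInl (k Λ : Type*) [Field k] [Ring Λ] [Algebra k Λ] : Λ →ₗ[k] TrivExt k Λ where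
  toFun := inl
  map_add' := inl_add _
  map_smul' := inl_smul _

@[simp] lemma trivExtInl_apply {k Λ : Type*} [Field k] [Ring Λ] [Algebra k Λ] (a : Λ) :
    trivExtInl k Λ a = inl a := rfl

/-- The first component of a central element of `T(Λ)` is central in `Λ`. -/
lemma fst_mem_center_of_mem_center {k Λ : Type*} [Field k] [Ring Λ] [Algebra k Λ]
    {c : TrivExt k Λ} (hc : c ∈ Subring.center (TrivExt k Λ)) :
    c.fst ∈ Subring.center Λ := by
  rw [Subring.mem_center_iff] at hc ⊢
  intro b
  simpa using congrArg TrivSqZeroExt.fst (hc (inl b))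

/-- A central element of `Λ` acts on `Λ*` in the same way from both sides. -/
lemma op_smul_dual_eq_smul_dual {k Λ : Type*} [Field k] [Ring Λ] [Algebra k Λ]
    {z : Λ} (hz : z ∈ Subring.center Λ) (φ : Module.Dual k Λ) : op z • φ = z • φ := by
  ext b
  simp [Subring.mem_center_iff.mp hz b]

/-- A central element of `Λ` is central in `T(Λ)`. -/
lemma inl_mem_center {k Λ : Type*} [Field k] [Ring Λ] [Algebra k Λ]
    {z : Λ} (hz : z ∈ Subring.center Λ) :
    (inl z : TrivExt k Λ) ∈ Subring.center (TrivExt k Λ) := by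
  rw [Subring.mem_center_iff]
  intro x
  ext1
  · simpa using Subring.mem_center_iff.mp hz x.fst
  · simp [op_smul_dual_eq_smul_dual hz]

/-- In characteristic `p`, the `p ^ n`-th power map kills the `Λ*`-part of central elements. -/
lemma pow_char_pow_eq_inl_of_mem_center {k Λ : Type*} [Field k] (p : ℕ) [CharP k p]
    [Ring Λ] [Algebra k Λ] {n : ℕ} (hn : 1 ≤ n) {c : TrivExt k Λ}
    (hc : c ∈ Subring.center (TrivExt k Λ)) : c ^ p ^ n = inl (c.fst ^ p ^ n) := by
  ext1
  · simp
  · have hp : ((p ^ n : ℕ) : k) = 0 := by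
      rw [Nat.cast_pow, CharP.cast_eq_zero, zero_pow (by omega)]
    rw [snd_pow_of_smul_comm _ _
      (op_smul_dual_eq_smul_dual (fst_mem_center_of_mem_center hc) c.snd), snd_inl,
      ← Nat.cast_smul_eq_nsmul k, hp, zero_smul]

/-- The `p ^ n`-th powers of central elements of `T(Λ)` are those of central elements of `Λ`. -/
lemma setOf_center_pow_eq_image_inl {k Λ : Type*} [Field k] (p : ℕ) [CharP k p]
    [Ring Λ] [Algebra k Λ] {n : ℕ} (hn : 1 ≤ n) :
    {y : TrivExt k Λ | ∃ c ∈ Subring.center (TrivExt k Λ), y = c ^ p ^ n} =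
      trivExtInl k Λ '' {w : Λ | ∃ z ∈ Subring.center Λ, w = z ^ p ^ n} := by
  ext y
  constructor
  · rintro ⟨c, hc, rfl⟩
    exact ⟨_, ⟨c.fst, fst_mem_center_of_mem_center hc, rfl⟩,
      (pow_char_pow_eq_inl_of_mem_center p hn hc).symm⟩
  · rintro ⟨_, ⟨z, hz, rfl⟩, rfl⟩
    exact ⟨inl z, inl_mem_center hz, by simp⟩

/-- for `n ≥ 1`, the subspace `P_n(Z(T(Λ)))` of `T(Λ)` spanned by the
`p^n`-th powers of central elements equals `P_n(Z(Λ)) ⋉ 0`, and its orthogonal space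
equals `Λ ⋉ Ann_{Λ*}(P_n(Z(Λ)))`: `(a,φ)` is orthogonal to `P_n(Z(T(Λ)))` iff
`φ (z^(p^n)) = 0` for all central `z ∈ Λ`, with no condition on `a`. -/
theorem stmt_14 (k Λ : Type*) [Field k] (p : ℕ) [Fact p.Prime] [CharP k p]
    [Ring Λ] [Algebra k Λ] [FiniteDimensional k Λ] (n : ℕ) (hn : 1 ≤ n) :
    (∀ x : TrivExt k Λ,
      x ∈ Submodule.span k
          {y : TrivExt k Λ | ∃ c ∈ Subring.center (TrivExt k Λ), y = c ^ p ^ n} ↔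
        (x.fst ∈ Submodule.span k {w : Λ | ∃ z ∈ Subring.center Λ, w = z ^ p ^ n} ∧
          x.snd = 0)) ∧
    (∀ x : TrivExt k Λ,
      (∀ m ∈ Submodule.span k
          {y : TrivExt k Λ | ∃ c ∈ Subring.center (TrivExt k Λ), y = c ^ p ^ n},
        trivExtForm k Λ x m = 0) ↔
        ∀ z ∈ Subring.center Λ, x.snd (z ^ p ^ n) = 0) := by
  rw [setOf_center_pow_eq_image_inl p hn, Submodule.span_image]
  refine ⟨fun x => ⟨?_, fun ⟨hx, hx'⟩ => ⟨x.fst, hx, ?_⟩⟩, fun x => ⟨fun h z hz => ?_, ?_⟩⟩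
  · rintro ⟨w, hw, rfl⟩
    exact ⟨by simpa using hw, by simp⟩
  · ext1 <;> simp [hx']
  · simpa [trivExtForm] using
      h (inl (z ^ p ^ n)) ⟨_, Submodule.subset_span ⟨z, hz, rfl⟩, rfl⟩
  · rintro h _ ⟨w, hw, rfl⟩
    have hle : Submodule.span k {w : Λ | ∃ z ∈ Subring.center Λ, w = z ^ p ^ n} ≤
        LinearMap.ker x.snd := by
      rw [Submodule.span_le]
      rintro _ ⟨z, hz, rfl⟩
      exact h z hz
    simpa [trivExtForm] using hle hw
end
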